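/- (Deduction Theorem for S1+SP) For every set of modal formulas Φ and all modal formulas φ, ψ: if ψ is derivable from Φ∪{φ} in S1+SP, then φ→ψ is derivable from Φ in S1+SP. -/

import Mathlib

/-- Modal formulas over countably many propositional variables x₀, x₁, …. -/
inductive Fm : Type
  | var : ℕ → Fm
  | neg : Fm → Fm
  | imp : Fm → Fm → Fm
  | box : Fm → Fm
deriving DecidableEq

namespace Fm

/-- ⊤ := x₀ → x₀ -/
def top : Fm := imp (var 0) (var 0)

/-- φ ∧ ψ := ¬(φ → ¬ψ) -/
def conj (φ ψ : Fm) : Fm := neg (imp φ (neg ψ))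

/-- φ ↔ ψ := (φ → ψ) ∧ (ψ → φ) -/
def biimp (φ ψ : Fm) : Fm := conj (imp φ ψ) (imp ψ φ)

/-- strict equivalence: φ ≡ ψ := □(φ → ψ) ∧ □(ψ → φ) -/
def equiv (φ ψ : Fm) : Fm := conj (box (imp φ ψ)) (box (imp ψ φ))

/-- φ[x := ψ]: substitution of ψ for all occurrences of the variable x in φ. -/
def subst (φ : Fm) (x : ℕ) (ψ : Fm) : Fm :=
  match φ with
  | var y => if y = x then ψ else var y
  | neg χ => neg (subst χ x ψ)
  | imp χ δ => imp (subst χ x ψ) (subst δ x ψ)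
  | box χ => box (subst χ x ψ)

/-- Propositional (two-valued) evaluation of a modal formula, treating
variables and boxed formulas as atoms. -/
def pEval (v : Fm → Bool) : Fm → Bool
  | var n => v (var n)
  | neg φ => !(pEval v φ)
  | imp φ ψ => !(pEval v φ) || pEval v ψ
  | box φ => v (box φ)

/-- φ has the form of a propositional tautology, i.e. φ is a substitution
instance of a propositional tautology. -/
def isTautInstance (φ : Fm) : Prop := ∀ v : Fm → Bool, pEval v φ = true

/-- The axioms (i)–(iii) of Lewis system S1 (Lemmon-style). -/
inductive S1Axiom : Fm → Prop
  | taut {φ} : isTautInstance φ → S1Axiom φ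
  | ax2 (φ) : S1Axiom (imp (box φ) φ)
  | ax3 (φ ψ χ) :
      S1Axiom (imp (conj (box (imp φ ψ)) (box (imp ψ χ))) (box (imp φ χ)))

/-- The identity axioms (iv)–(vi), i.e. the Substitution Principle SP. -/
inductive SPAxiom : Fm → Prop
  | ax4 (φ ψ) : SPAxiom (imp (equiv φ ψ) (equiv (neg φ) (neg ψ)))
  | ax5 (φ ψ φ' ψ') :
      SPAxiom (imp (conj (equiv φ ψ) (equiv φ' ψ'))
        (equiv (imp φ φ') (imp ψ ψ')))
  | ax6 (φ ψ) : SPAxiom (imp (equiv φ ψ) (equiv (box φ) (box ψ)))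

/-- Derivability in S1+SP from a set Φ of premises: axioms (i)–(vi),
modus ponens, and Axiom Necessitation AN restricted to axioms (i)–(iii). -/
inductive S1SP : Set Fm → Fm → Prop
  | prem {Φ φ} : φ ∈ Φ → S1SP Φ φ
  | axm {Φ φ} : S1Axiom φ → S1SP Φ φ
  | spAxm {Φ φ} : SPAxiom φ → S1SP Φ φ
  | mp {Φ φ ψ} : S1SP Φ (imp φ ψ) → S1SP Φ φ → S1SP Φ ψ
  | an {Φ φ} : S1Axiom φ → S1SP Φ (box φ)

end Fm

theorem Fm.weaken {Φ : Set Fm} (φ : Fm) {ψ : Fm} (h : Fm.S1SP Φ ψ) : Fm.S1SP Φ (Fm.imp φ ψ) := by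
  refine Fm.S1SP.mp (Fm.S1SP.axm (Fm.S1Axiom.taut ?_)) h
  intro v
  simp only [Fm.pEval]
  cases Fm.pEval v φ <;> cases Fm.pEval v ψ <;> rfl

open Fm in
/-- Deduction Theorem for S1+SP. -/
theorem deduction_theorem (Φ : Set Fm) (φ ψ : Fm)
    (h : S1SP (Φ ∪ {φ}) ψ) : S1SP Φ (imp φ ψ) := by
  induction h with
  | @prem χ hm =>
    rcases hm with hm | hm
    · exact Fm.weaken φ (S1SP.prem hm)
    · have e : χ = φ := hm
      subst e
      refine S1SP.axm (S1Axiom.taut ?_)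
      intro v
      simp only [pEval]
      cases pEval v χ <;> rfl
  | axm ha => exact Fm.weaken φ (S1SP.axm ha)
  | spAxm ha => exact Fm.weaken φ (S1SP.spAxm ha)
  | an ha => exact Fm.weaken φ (S1SP.an ha)
  | @mp α β _ _ ih1 ih2 =>
    refine S1SP.mp (S1SP.mp (S1SP.axm (S1Axiom.taut ?_)) ih1) ih2
    intro v
    simp only [pEval]
    cases pEval v φ <;> cases pEval v α <;> cases pEval v β <;> rfl
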